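/- arXiv:2002.08625 — 2 statements merged into one kernel-verified Lean document; each statement's English description precedes it below -/
import Mathlib

section
/- Let n, m ∈ ℕ, B ∈ ℝ^{n×m}, β > 0, let f : ℝⁿ → ℝⁿ be continuous, and let V ∈ C¹(ℝⁿ, ℝ) satisfy the HJB equation ⟨f(y), ∇V(y)⟩ − (1/(2β))|Bᵀ∇V(y)|² + (1/2)|y|² = 0 for every y ∈ ℝⁿ. Let y₀ ∈ ℝⁿ and let y : [0,∞) → ℝⁿ be differentiable with y(0) = y₀ and ẏ(t) = f(y(t)) − (1/β) B Bᵀ ∇V(y(t)) for all t ≥ 0. Then for every t ≥ 0 one has 2 V(y(t)) + ∫₀ᵗ |y(s)|² ds + (1/β) ∫₀ᵗ |Bᵀ ∇V(y(s))|² ds = 2 V(y₀). -/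
open MeasureTheory
open scoped RealInnerProductSpace

/-- If `V ∈ C¹(ℝⁿ,ℝ)` solves the stationary HJB equation
`⟨f(y), ∇V(y)⟩ − (1/(2β))|Bᵀ∇V(y)|² + (1/2)|y|² = 0` and `y` solves the optimal
closed-loop system `ẏ = f(y) − (1/β) B Bᵀ ∇V(y)`, `y(0) = y₀`, then
`2 V(y(t)) + ∫₀ᵗ |y(s)|² ds + (1/β) ∫₀ᵗ |Bᵀ ∇V(y(s))|² ds = 2 V(y₀)` for all `t ≥ 0`. -/
theorem stmt0
    (n m : ℕ)
    (B : EuclideanSpace ℝ (Fin m) →L[ℝ] EuclideanSpace ℝ (Fin n))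
    (β : ℝ) (hβ : 0 < β)
    (f : EuclideanSpace ℝ (Fin n) → EuclideanSpace ℝ (Fin n)) (hf : Continuous f)
    (V : EuclideanSpace ℝ (Fin n) → ℝ) (hV : ContDiff ℝ 1 V)
    (hHJB : ∀ z : EuclideanSpace ℝ (Fin n),
      ⟪f z, gradient V z⟫
        - (1 / (2 * β)) * ‖ContinuousLinearMap.adjoint B (gradient V z)‖ ^ 2
        + (1 / 2) * ‖z‖ ^ 2 = 0)
    (y₀ : EuclideanSpace ℝ (Fin n)) (y : ℝ → EuclideanSpace ℝ (Fin n))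
    (hy0 : y 0 = y₀)
    (hy : ∀ t ≥ (0:ℝ), HasDerivWithinAt y
      (f (y t) - β⁻¹ • B (ContinuousLinearMap.adjoint B (gradient V (y t))))
      (Set.Ici 0) t) :
    ∀ t ≥ (0:ℝ),
      2 * V (y t) + (∫ s in (0:ℝ)..t, ‖y s‖ ^ 2)
        + β⁻¹ * ∫ s in (0:ℝ)..t, ‖ContinuousLinearMap.adjoint B (gradient V (y s))‖ ^ 2
      = 2 * V y₀ := by
  intro t ht
  have hgrad : Continuous (gradient V) := by
    unfold gradient
    exact (LinearIsometryEquiv.continuous _).comp (hV.continuous_fderiv (by norm_num))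
  have hyc : ContinuousOn y (Set.Icc 0 t) := fun s hs =>
    ((hy s hs.1).continuousWithinAt).mono Set.Icc_subset_Ici_self
  have hc1 : ContinuousOn (fun s => ‖y s‖ ^ 2) (Set.Icc 0 t) := (hyc.norm).pow 2
  have hc2 : ContinuousOn
      (fun s => ‖ContinuousLinearMap.adjoint B (gradient V (y s))‖ ^ 2) (Set.Icc 0 t) :=
    ((((ContinuousLinearMap.adjoint B).continuous.comp hgrad).comp_continuousOn hyc).norm).pow 2
  have hi1 : IntervalIntegrable (fun s => ‖y s‖ ^ 2) volume 0 t :=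
    ContinuousOn.intervalIntegrable_of_Icc ht hc1
  have hi2 : IntervalIntegrable
      (fun s => ‖ContinuousLinearMap.adjoint B (gradient V (y s))‖ ^ 2) volume 0 t :=
    ContinuousOn.intervalIntegrable_of_Icc ht hc2
  have hd : ∀ s ∈ Set.Ioo (0:ℝ) t, HasDerivWithinAt (fun s => -(2 * V (y s)))
      (‖y s‖ ^ 2 + β⁻¹ * ‖ContinuousLinearMap.adjoint B (gradient V (y s))‖ ^ 2)
      (Set.Ioi s) s := by
    intro s hs
    have h1 := (hy s hs.1.le).mono
      (show Set.Ioi s ⊆ Set.Ici 0 from fun x hx => hs.1.le.trans (le_of_lt hx))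
    have hg : HasGradientAt V (gradient V (y s)) (y s) :=
      ((hV.differentiable (by norm_num)) (y s)).hasGradientAt
    have h2 := ((hg.hasFDerivAt.comp_hasDerivWithinAt s h1).const_mul 2).neg
    refine h2.congr_deriv ?_
    have h3 := hHJB (y s)
    rw [InnerProductSpace.toDual_apply_apply, inner_sub_right, inner_smul_right,
      ← ContinuousLinearMap.adjoint_inner_left, real_inner_self_eq_norm_sq,
      real_inner_comm]
    have h4 : 1 / (2 * β) = β⁻¹ / 2 := by field_simp
    rw [h4] at h3
    linarith
  have key := intervalIntegral.integral_eq_sub_of_hasDeriv_right_of_le ht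
    ((hV.continuous.comp_continuousOn hyc).const_smul (2:ℝ)).neg hd (hi1.add (hi2.const_mul _))
  rw [intervalIntegral.integral_add hi1 (hi2.const_mul _),
    intervalIntegral.integral_const_mul] at key
  simp only [Pi.neg_apply, Pi.smul_apply, Function.comp_apply, smul_eq_mul, hy0] at key
  linarith
end

section
/- Fix an architecture (N₀, N₁, …, N_L) with N₀ = n, N_L = m, and let σ ∈ C¹(ℝ, ℝ). Let θ_k, θ be parameter tuples (W₁,b₁,…,W_L,b_L) for this architecture with θ_k → θ (entrywise convergence), and let F_{θ_k}, F_θ denote the corresponding shifted realizations. Then for all R > 0 and C > 0, lim_{k→∞} sup { (∫₀^∞ |F_{θ_k}(y(t)) − F_θ(y(t))|² dt)^{1/2} : y : [0,∞) → ℝⁿ measurable, |y(t)| ≤ R for all t ≥ 0, ∫₀^∞ |y(t)|² dt ≤ C² } = 0. -/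
open MeasureTheory Filter

/-- Matrix-vector multiplication as a map between Euclidean spaces. -/
noncomputable def matVecE {p q : ℕ} (W : Matrix (Fin q) (Fin p) ℝ)
    (x : EuclideanSpace ℝ (Fin p)) : EuclideanSpace ℝ (Fin q) :=
  (EuclideanSpace.equiv (Fin q) ℝ).symm (W.mulVec (EuclideanSpace.equiv (Fin p) ℝ x))

/-- Componentwise application of the activation function. -/
noncomputable def actE (σ : ℝ → ℝ) {q : ℕ} (v : EuclideanSpace ℝ (Fin q)) :
    EuclideanSpace ℝ (Fin q) :=
  (EuclideanSpace.equiv (Fin q) ℝ).symm fun j => σ (v j)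

/-- The composition `s_{k+1} ∘ ⋯ ∘ s₁` of `k+1` hidden layers `sᵢ(x) = σ(Wᵢ x + bᵢ)`,
with input dimension `n` and output dimensions `N 0, N 1, …`. -/
noncomputable def hiddenStack (σ : ℝ → ℝ) (n : ℕ) (N : ℕ → ℕ)
    (W0 : Matrix (Fin (N 0)) (Fin n) ℝ) (b0 : EuclideanSpace ℝ (Fin (N 0)))
    (W : ∀ i : ℕ, Matrix (Fin (N (i+1))) (Fin (N i)) ℝ)
    (b : ∀ i : ℕ, EuclideanSpace ℝ (Fin (N (i+1)))) :
    (k : ℕ) → EuclideanSpace ℝ (Fin n) → EuclideanSpace ℝ (Fin (N k))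
  | 0 => fun x => actE σ (matVecE W0 x + b0)
  | (k+1) => fun x => actE σ (matVecE (W k) (hiddenStack σ n N W0 b0 W b k x) + b k)

/-- The full (unshifted) realization of a network with `k+1` hidden layers and a final affine
layer `x ↦ W_L x + b_L`. -/
noncomputable def fullNet (σ : ℝ → ℝ) (n m : ℕ) (N : ℕ → ℕ) (k : ℕ)
    (W0 : Matrix (Fin (N 0)) (Fin n) ℝ) (b0 : EuclideanSpace ℝ (Fin (N 0)))
    (W : ∀ i : ℕ, Matrix (Fin (N (i+1))) (Fin (N i)) ℝ)
    (b : ∀ i : ℕ, EuclideanSpace ℝ (Fin (N (i+1))))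
    (WL : Matrix (Fin m) (Fin (N k)) ℝ) (bL : EuclideanSpace ℝ (Fin m))
    (x : EuclideanSpace ℝ (Fin n)) : EuclideanSpace ℝ (Fin m) :=
  matVecE WL (hiddenStack σ n N W0 b0 W b k x) + bL

/-- The shifted realization `F_θ(x) = (f_L∘⋯∘f₁)(x) − (f_L∘⋯∘f₁)(0)`, so `F_θ(0) = 0`. -/
noncomputable def shiftedNet (σ : ℝ → ℝ) (n m : ℕ) (N : ℕ → ℕ) (k : ℕ)
    (W0 : Matrix (Fin (N 0)) (Fin n) ℝ) (b0 : EuclideanSpace ℝ (Fin (N 0)))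
    (W : ∀ i : ℕ, Matrix (Fin (N (i+1))) (Fin (N i)) ℝ)
    (b : ∀ i : ℕ, EuclideanSpace ℝ (Fin (N (i+1))))
    (WL : Matrix (Fin m) (Fin (N k)) ℝ) (bL : EuclideanSpace ℝ (Fin m))
    (x : EuclideanSpace ℝ (Fin n)) : EuclideanSpace ℝ (Fin m) :=
  fullNet σ n m N k W0 b0 W b WL bL x - fullNet σ n m N k W0 b0 W b WL bL 0

/-- A continuous divided difference for a `C¹` function. -/
theorem exists_divDiff (σ : ℝ → ℝ) (hσ : ContDiff ℝ 1 σ) :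
    ∃ S : ℝ × ℝ → ℝ, Continuous S ∧ ∀ a b, σ a - σ b = S (a, b) * (a - b) := by
  have hd : Continuous (deriv σ) := hσ.continuous_deriv le_rfl
  refine ⟨fun p => ∫ t in (0:ℝ)..1, deriv σ (p.2 + t • (p.1 - p.2)), ?_, ?_⟩
  · apply intervalIntegral.continuous_parametric_intervalIntegral_of_continuous'
    fun_prop
  · intro a b
    have h := intervalIntegral.integral_unitInterval_deriv_eq_sub (𝕜 := ℝ) (f := σ)
      (f' := deriv σ) (z₀ := b) (z₁ := a - b) (by fun_prop)
      (fun t _ => (hσ.differentiable (by norm_num)).differentiableAt.hasDerivAt)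
    rw [smul_eq_mul] at h
    have e : b + (a - b) = a := by ring
    rw [e] at h
    rw [← h]
    ring

/-- Joint convergence of values, base values and difference quotients. -/
def ConvQ {ι : Type} (l : Filter ι) (r : ι → ℝ) {d : ℕ}
    (p p0 : ι → EuclideanSpace ℝ (Fin d)) (A a c : Fin d → ℝ) : Prop :=
  ∀ j, Tendsto (fun i => p i j) l (nhds (A j)) ∧ Tendsto (fun i => p0 i j) l (nhds (a j)) ∧
    Tendsto (fun i => (p i j - p0 i j) / r i) l (nhds (c j))

theorem ConvQ.affine {ι : Type} {l : Filter ι} {r : ι → ℝ} {d e : ℕ}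
    {p p0 : ι → EuclideanSpace ℝ (Fin d)} {A a c : Fin d → ℝ} (h : ConvQ l r p p0 A a c)
    {Ws : ι → Matrix (Fin e) (Fin d) ℝ} {W : Matrix (Fin e) (Fin d) ℝ}
    {bs : ι → EuclideanSpace ℝ (Fin e)} {b : EuclideanSpace ℝ (Fin e)}
    (hW : ∀ i j, Tendsto (fun k => Ws k i j) l (nhds (W i j)))
    (hb : ∀ j, Tendsto (fun k => bs k j) l (nhds (b j))) :
    ConvQ l r (fun i => matVecE (Ws i) (p i) + bs i) (fun i => matVecE (Ws i) (p0 i) + bs i)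
      (fun j => ∑ s, W j s * A s + b j) (fun j => ∑ s, W j s * a s + b j)
      (fun j => ∑ s, W j s * c s) := by
  have key : ∀ (V : Matrix (Fin e) (Fin d) ℝ) (x : EuclideanSpace ℝ (Fin d))
      (v : EuclideanSpace ℝ (Fin e)) (j : Fin e),
      (matVecE V x + v) j = ∑ s, V j s * x s + v j := by
    intro V x v j
    simp [matVecE, Matrix.mulVec, dotProduct]
  intro j
  simp only [key]
  refine ⟨?_, ?_, ?_⟩
  · exact (tendsto_finsetSum _ fun s _ => (hW j s).mul (h s).1).add (hb j)
  · exact (tendsto_finsetSum _ fun s _ => (hW j s).mul (h s).2.1).add (hb j)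
  · have h3 := tendsto_finsetSum Finset.univ fun s _ => (hW j s).mul (h s).2.2
    refine h3.congr fun i => ?_
    rw [add_sub_add_right_eq_sub, ← Finset.sum_sub_distrib, Finset.sum_div]
    refine Finset.sum_congr rfl fun s _ => ?_
    ring

theorem ConvQ.act {ι : Type} {l : Filter ι} {r : ι → ℝ} {d : ℕ}
    {p p0 : ι → EuclideanSpace ℝ (Fin d)} {A a c : Fin d → ℝ} (h : ConvQ l r p p0 A a c)
    {σ : ℝ → ℝ} (hσ : Continuous σ) {S : ℝ × ℝ → ℝ} (hS : Continuous S)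
    (hs : ∀ a b, σ a - σ b = S (a, b) * (a - b)) :
    ConvQ l r (fun i => actE σ (p i)) (fun i => actE σ (p0 i))
      (fun j => σ (A j)) (fun j => σ (a j)) (fun j => S (A j, a j) * c j) := by
  have key : ∀ (x : EuclideanSpace ℝ (Fin d)) (j : Fin d), (actE σ x) j = σ (x j) := by
    intro x j
    simp [actE]
  intro j
  simp only [key]
  obtain ⟨h1, h2, h3⟩ := h j
  refine ⟨(hσ.tendsto _).comp h1, (hσ.tendsto _).comp h2, ?_⟩
  have h4 := ((hS.tendsto _).comp (h1.prodMk_nhds h2)).mul h3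
  refine h4.congr fun i => ?_
  simp only [Function.comp, hs]
  ring

theorem convQ_hidden {ι : Type} (l : Filter ι) (r : ι → ℝ) (σ : ℝ → ℝ) (hσ : ContDiff ℝ 1 σ)
    (n : ℕ) (N : ℕ → ℕ) (K : ℕ)
    (x x0 : ι → EuclideanSpace ℝ (Fin n)) {X X0 c0 : Fin n → ℝ} (hx : ConvQ l r x x0 X X0 c0)
    (W0 : Matrix (Fin (N 0)) (Fin n) ℝ) (b0 : EuclideanSpace ℝ (Fin (N 0)))
    (W : ∀ i : ℕ, Matrix (Fin (N (i+1))) (Fin (N i)) ℝ)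
    (b : ∀ i : ℕ, EuclideanSpace ℝ (Fin (N (i+1)))) (k : ℕ) (hk : k ≤ K) :
    ∃ A a c : Fin (N k) → ℝ, ∀ (W0s : ι → Matrix (Fin (N 0)) (Fin n) ℝ)
      (b0s : ι → EuclideanSpace ℝ (Fin (N 0)))
      (Ws : ι → ∀ i : ℕ, Matrix (Fin (N (i+1))) (Fin (N i)) ℝ)
      (bs : ι → ∀ i : ℕ, EuclideanSpace ℝ (Fin (N (i+1)))),
      (∀ i j, Tendsto (fun k => W0s k i j) l (nhds (W0 i j))) →
      (∀ j, Tendsto (fun k => b0s k j) l (nhds (b0 j))) →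
      (∀ i < K, ∀ p q, Tendsto (fun k => Ws k i p q) l (nhds (W i p q))) →
      (∀ i < K, ∀ p, Tendsto (fun k => bs k i p) l (nhds (b i p))) →
      ConvQ l r (fun i => hiddenStack σ n N (W0s i) (b0s i) (Ws i) (bs i) k (x i))
        (fun i => hiddenStack σ n N (W0s i) (b0s i) (Ws i) (bs i) k (x0 i)) A a c := by
  obtain ⟨S, hS, hs⟩ := exists_divDiff σ hσ
  induction k with
  | zero =>
    exact ⟨_, _, _, fun W0s b0s Ws bs hW0 hb0 hW hb => (hx.affine hW0 hb0).act hσ.continuous hS hs⟩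
  | succ k ih =>
    obtain ⟨A, a, c, h⟩ := ih (by omega)
    exact ⟨_, _, _, fun W0s b0s Ws bs hW0 hb0 hW hb => ((h W0s b0s Ws bs hW0 hb0 hW hb).affine (hW k (by omega)) (hb k (by omega))).act
      hσ.continuous hS hs⟩

theorem exists_ultra_lim {ι E : Type} [TopologicalSpace E] (l : Ultrafilter ι) (f : ι → E)
    {s : Set E} (hs : IsCompact s) (h : Tendsto f (l : Filter ι) (principal s)) :
    ∃ x, Tendsto f (l : Filter ι) (nhds x) := by
  obtain ⟨x, -, hx⟩ := hs.ultrafilter_le_nhds (l.map f) h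
  exact ⟨x, hx⟩

/-- For a fixed architecture with `L ≥ 2` layers and a `C¹` activation `σ`,
if the parameters `θ_k` converge entrywise to `θ`, then the `L²`-distance of the shifted
realizations `F_{θ_k}` and `F_θ` along trajectories converges to `0` uniformly over all
measurable `y : [0,∞) → ℝⁿ` with `|y(t)| ≤ R` and `∫₀^∞ |y|² ≤ C²`. -/
theorem stmt9
    (n m : ℕ) (σ : ℝ → ℝ) (hσ : ContDiff ℝ 1 σ)
    (L : ℕ) (hL : 2 ≤ L) (N : ℕ → ℕ)
    (W0s : ℕ → Matrix (Fin (N 0)) (Fin n) ℝ) (W0 : Matrix (Fin (N 0)) (Fin n) ℝ)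
    (b0s : ℕ → EuclideanSpace ℝ (Fin (N 0))) (b0 : EuclideanSpace ℝ (Fin (N 0)))
    (Ws : ℕ → ∀ i : ℕ, Matrix (Fin (N (i+1))) (Fin (N i)) ℝ)
    (W : ∀ i : ℕ, Matrix (Fin (N (i+1))) (Fin (N i)) ℝ)
    (bs : ℕ → ∀ i : ℕ, EuclideanSpace ℝ (Fin (N (i+1))))
    (b : ∀ i : ℕ, EuclideanSpace ℝ (Fin (N (i+1))))
    (WLs : ℕ → Matrix (Fin m) (Fin (N (L-2))) ℝ) (WL : Matrix (Fin m) (Fin (N (L-2))) ℝ)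
    (bLs : ℕ → EuclideanSpace ℝ (Fin m)) (bL : EuclideanSpace ℝ (Fin m))
    (hW0 : ∀ i j, Tendsto (fun k => W0s k i j) atTop (nhds (W0 i j)))
    (hb0 : ∀ j, Tendsto (fun k => b0s k j) atTop (nhds (b0 j)))
    (hW : ∀ i < L - 2, ∀ p q, Tendsto (fun k => Ws k i p q) atTop (nhds (W i p q)))
    (hb : ∀ i < L - 2, ∀ p, Tendsto (fun k => bs k i p) atTop (nhds (b i p)))
    (hWL : ∀ i j, Tendsto (fun k => WLs k i j) atTop (nhds (WL i j)))
    (hbL : ∀ j, Tendsto (fun k => bLs k j) atTop (nhds (bL j)))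
    (R C : ℝ) (hR : 0 < R) (hC : 0 < C) :
    ∀ ε > (0:ℝ), ∃ k₀ : ℕ, ∀ k ≥ k₀,
      ∀ y : ℝ → EuclideanSpace ℝ (Fin n), Measurable y →
        (∀ t ≥ (0:ℝ), ‖y t‖ ≤ R) →
        (∫⁻ t in Set.Ioi (0:ℝ), ENNReal.ofReal (‖y t‖ ^ 2)) ≤ ENNReal.ofReal (C ^ 2) →
        Real.sqrt (∫ t in Set.Ioi (0:ℝ),
            ‖shiftedNet σ n m N (L-2) (W0s k) (b0s k) (Ws k) (bs k) (WLs k) (bLs k) (y t)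
              - shiftedNet σ n m N (L-2) W0 b0 W b WL bL (y t)‖ ^ 2) ≤ ε := by
  intro ε hε
  set D : ℕ × EuclideanSpace ℝ (Fin n) → EuclideanSpace ℝ (Fin m) := fun z =>
    shiftedNet σ n m N (L-2) (W0s z.1) (b0s z.1) (Ws z.1) (bs z.1) (WLs z.1) (bLs z.1) z.2
      - shiftedNet σ n m N (L-2) W0 b0 W b WL bL z.2 with hD
  have main : Tendsto (fun z => ‖z.2‖⁻¹ • D z)
      (atTop ×ˢ principal (Metric.closedBall (0 : EuclideanSpace ℝ (Fin n)) R)) (nhds 0) := by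
    rw [tendsto_iff_ultrafilter]
    intro l hl
    have hfst : Tendsto Prod.fst (l : Filter (ℕ × EuclideanSpace ℝ (Fin n))) atTop :=
      tendsto_fst.mono_left hl
    have hsnd : Tendsto Prod.snd (l : Filter (ℕ × EuclideanSpace ℝ (Fin n)))
        (principal (Metric.closedBall 0 R)) := tendsto_snd.mono_left hl
    obtain ⟨X, hX'⟩ := exists_ultra_lim l _ (isCompact_closedBall _ _) hsnd
    have hunit : Tendsto (fun z : ℕ × EuclideanSpace ℝ (Fin n) => ‖z.2‖⁻¹ • z.2)
        (l : Filter (ℕ × EuclideanSpace ℝ (Fin n))) (principal (Metric.closedBall 0 1)) := by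
      rw [tendsto_principal]
      refine Eventually.of_forall fun z => ?_
      rw [mem_closedBall_zero_iff, norm_smul, norm_inv, norm_norm]
      exact inv_mul_le_one
    obtain ⟨c, hc'⟩ := exists_ultra_lim l _ (isCompact_closedBall _ _) hunit
    have hx : ConvQ (l : Filter (ℕ × EuclideanSpace ℝ (Fin n))) (fun z => ‖z.2‖)
        (fun z => z.2) (fun _ => 0) X (fun _ => 0) c := by
      intro j
      have hcont : Continuous fun v : EuclideanSpace ℝ (Fin n) => v j := by fun_prop
      refine ⟨(hcont.tendsto _).comp hX', by simp, ?_⟩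
      refine ((hcont.tendsto _).comp hc').congr fun z => ?_
      simp [div_eq_inv_mul]
    obtain ⟨A, a, q, h⟩ := convQ_hidden _ _ σ hσ n N (L-2) _ _ hx W0 b0 W b (L-2) le_rfl
    have h1 := (h (fun z => W0s z.1) (fun z => b0s z.1) (fun z => Ws z.1) (fun z => bs z.1)
      (fun i j => (hW0 i j).comp hfst) (fun j => (hb0 j).comp hfst)
      (fun i hi p q => (hW i hi p q).comp hfst) (fun i hi p => (hb i hi p).comp hfst)).affine
      (Ws := fun z => WLs z.1) (bs := fun z => bLs z.1)
      (fun i j => (hWL i j).comp hfst) (fun j => (hbL j).comp hfst)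
    have h2 := (h (fun z => W0) (fun z => b0) (fun z => W) (fun z => b)
      (fun i j => tendsto_const_nhds) (fun j => tendsto_const_nhds)
      (fun i hi p q => tendsto_const_nhds) (fun i hi p => tendsto_const_nhds)).affine
      (Ws := fun z => WL) (bs := fun z => bL)
      (fun i j => tendsto_const_nhds) (fun j => tendsto_const_nhds)
    have hcoord : Tendsto (fun z => (EuclideanSpace.equiv (Fin m) ℝ) (‖z.2‖⁻¹ • D z))
        (l : Filter (ℕ × EuclideanSpace ℝ (Fin n))) (nhds 0) := by
      rw [tendsto_pi_nhds]
      intro j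
      have h3 := (h1 j).2.2.sub (h2 j).2.2
      rw [sub_self] at h3
      refine h3.congr fun z => ?_
      simp only [hD, shiftedNet, fullNet, PiLp.coe_continuousLinearEquiv, PiLp.smul_apply,
        PiLp.sub_apply, smul_eq_mul, EuclideanSpace.equiv]
      ring
    have h5 := ((EuclideanSpace.equiv (Fin m) ℝ).symm.continuous.tendsto 0).comp hcoord
    rw [map_zero] at h5
    refine h5.congr fun z => ?_
    simp
  have hδ : 0 < ε / C := div_pos hε hC
  have hev := main.norm.eventually_lt_const (u := ε / C) (by simpa using hδ)
  rw [eventually_prod_principal_iff] at hev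
  obtain ⟨k₀, hk₀⟩ := eventually_atTop.1 hev
  refine ⟨k₀, fun k hk y hy hyR hyC => ?_⟩
  have hbound : ∀ x : EuclideanSpace ℝ (Fin n), ‖x‖ ≤ R → ‖D (k, x)‖ ≤ ε / C * ‖x‖ := by
    intro x hxR
    rcases eq_or_ne x 0 with rfl | hx0
    · simp [hD, shiftedNet]
    · have := hk₀ k hk x (by simpa using hxR)
      have hpos : 0 < ‖x‖ := norm_pos_iff.2 hx0
      rw [norm_smul, norm_inv, norm_norm, inv_mul_lt_iff₀ hpos] at this
      linarith
  have hmeas : Measurable fun t => ‖y t‖ ^ 2 := by fun_prop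
  have hint : Integrable (fun t => ‖y t‖ ^ 2) (volume.restrict (Set.Ioi (0:ℝ))) := by
    refine ⟨hmeas.aestronglyMeasurable, ?_⟩
    rw [hasFiniteIntegral_iff_ofReal (Eventually.of_forall fun t => by positivity)]
    exact hyC.trans_lt ENNReal.ofReal_lt_top
  have hI : ∫ t in Set.Ioi (0:ℝ), ‖y t‖ ^ 2 ≤ C ^ 2 := by
    rw [integral_eq_lintegral_of_nonneg_ae (Eventually.of_forall fun t => by positivity)
      hmeas.aestronglyMeasurable]
    exact ENNReal.toReal_le_of_le_ofReal (by positivity) hyC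
  have hle : ∫ t in Set.Ioi (0:ℝ), ‖D (k, y t)‖ ^ 2
      ≤ ∫ t in Set.Ioi (0:ℝ), (ε / C) ^ 2 * ‖y t‖ ^ 2 := by
    refine integral_mono_of_nonneg (Eventually.of_forall fun t => by positivity)
      (hint.const_mul _) ?_
    filter_upwards [ae_restrict_mem measurableSet_Ioi] with t ht
    have := hbound (y t) (hyR t (le_of_lt ht))
    calc ‖D (k, y t)‖ ^ 2 ≤ (ε / C * ‖y t‖) ^ 2 := by gcongr
      _ = _ := by ring
  rw [integral_const_mul] at hle
  refine Real.sqrt_le_iff.2 ⟨hε.le, hle.trans ?_⟩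
  calc (ε / C) ^ 2 * ∫ t in Set.Ioi (0:ℝ), ‖y t‖ ^ 2 ≤ (ε / C) ^ 2 * C ^ 2 := by gcongr
    _ = ε ^ 2 := by field_simp
end
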